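/- Let θ be an infinite cardinal such that 𝔟 ≤ θ and cov(ω,θ) ≤ θ. Then the following are equivalent: (i) there is a (θ,θ)-good set; (ii) there is a ≤⁺-unbounded family F = {f_β : β < θ} of functions from θ to ω such that every G ⊆ F with |G| < θ is ≤⁺-bounded, and for every B ⊆ θ with |B| < θ the family of restrictions {f_β ↾ B : β < θ} is ≤⁺-bounded (as functions from B to ω). -/

import Mathlib

open Cardinal Set

universe u

/-- `f ≤⁺ g`: there is `k` such that for every `α`, `f α ≤ g α` or `f α ≤ k`. -/
def LePlus {I : Type u} (f g : I → ℕ) : Prop :=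
  ∃ k : ℕ, ∀ α, f α ≤ g α ∨ f α ≤ k

/-- `f ≤* g`: `f α ≤ g α` for all but finitely many `α`. -/
def LeStar {I : Type u} (f g : I → ℕ) : Prop :=
  {α | ¬ f α ≤ g α}.Finite

/-- The trace `V_g × U_f` of a basic neighborhood of `(∞,∞)` in `F_θ × F_λ`. -/
def VU {Θ Λ : Type u} (g : Θ → ℕ) (f : Λ → ℕ) : Set ((Θ × ℕ) × (Λ × ℕ)) :=
  {p | g p.1.1 < p.1.2 ∧ f p.2.1 < p.2.2}

/-- `A` is a `(θ,θ)`-good set, where `θ = #Θ` (clauses (a)–(d)). -/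
def IsGoodSelf {Θ : Type u} (A : Set ((Θ × ℕ) × (Θ × ℕ))) : Prop :=
  (∀ g f : Θ → ℕ, (A ∩ VU g f).Nonempty) ∧
  (∀ B ⊆ A, #B < #Θ → ∃ g f : Θ → ℕ, B ∩ VU g f = ∅) ∧
  (∀ E : Set Θ, #E < #Θ → ∃ g f : Θ → ℕ, A ∩ {p | p.2.1 ∈ E} ∩ VU g f = ∅) ∧
  (∀ F : Set Θ, #F < #Θ → ∃ g f : Θ → ℕ, A ∩ {p | p.1.1 ∈ F} ∩ VU g f = ∅)

/-- The construction for a set all of whose points satisfy `m ≤ n`. -/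
lemma core_dir {Θ : Type} [Infinite Θ]
    (hbθ : ∃ F : Set (ℕ → ℕ), #F ≤ #Θ ∧ ¬ ∃ g : ℕ → ℕ, ∀ f ∈ F, LeStar f g)
    (hcov : ∃ C : Set (Set Θ), #C ≤ #Θ ∧ (∀ c ∈ C, c.Countable) ∧
      ∀ B : Set Θ, B.Countable → ∃ c ∈ C, B ⊆ c)
    (R : Θ → ℕ → Θ → ℕ → Prop)
    (hmn : ∀ β m α n, R β m α n → m ≤ n)
    (ha : ∀ g f : Θ → ℕ, ∃ β m α n, R β m α n ∧ g β < m ∧ f α < n)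
    (hc : ∀ E : Set Θ, #E < #Θ → ∃ g f : Θ → ℕ, ∀ β m α n, R β m α n → α ∈ E → g β < m → n ≤ f α)
    (hd : ∀ E : Set Θ, #E < #Θ → ∃ g f : Θ → ℕ, ∀ β m α n, R β m α n → β ∈ E → g β < m → n ≤ f α) :
    (∃ f : Θ → Θ → ℕ,
      (¬ ∃ g : Θ → ℕ, ∀ β : Θ, LePlus (f β) g) ∧
      (∀ G : Set Θ, #G < #Θ → ∃ g : Θ → ℕ, ∀ β ∈ G, LePlus (f β) g) ∧
      (∀ B : Set Θ, #B < #Θ →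
        ∃ g : B → ℕ, ∀ β : Θ, LePlus (fun α : B => f β α) g)) := by
  classical
  obtain ⟨F, hFc, hF⟩ := hbθ
  obtain ⟨C, hCc, hCC, hCB⟩ := hcov
  -- indexings
  obtain ⟨xf, hxf⟩ : ∃ xf : Θ → ℕ → ℕ, ∀ y : ℕ → ℕ, ∃ i, ¬ LeStar (xf i) y := by
    obtain ⟨emb⟩ := hFc
    have : Nonempty F := by
      by_contra h
      rw [not_nonempty_iff] at h
      exact hF ⟨fun _ => 0, fun f hf => (h.false ⟨f, hf⟩).elim⟩
    refine ⟨fun i => (Function.invFun emb i : F), fun y => ?_⟩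
    by_contra h
    push Not at h
    refine hF ⟨y, fun f hf => ?_⟩
    have := h (emb ⟨f, hf⟩)
    rwa [Function.leftInverse_invFun emb.injective] at this
  obtain ⟨cf, hcfc, hcf⟩ : ∃ cf : Θ → Set Θ, (∀ i, (cf i).Countable) ∧
      ∀ B : Set Θ, B.Countable → ∃ i, B ⊆ cf i := by
    obtain ⟨emb⟩ := hCc
    have : Nonempty C := by
      obtain ⟨c, hc, _⟩ := hCB ∅ countable_empty
      exact ⟨⟨c, hc⟩⟩
    refine ⟨fun i => (Function.invFun emb i : C), fun i => hCC _ (Subtype.prop _), fun B hB => ?_⟩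
    obtain ⟨c, hc, hBc⟩ := hCB B hB
    refine ⟨emb ⟨c, hc⟩, ?_⟩
    dsimp only
    rwa [Function.leftInverse_invFun emb.injective]
  obtain ⟨e⟩ : Nonempty (Θ ≃ Θ × Θ × Θ) := by
    apply Cardinal.eq.1
    simp [Cardinal.mul_eq_self (Cardinal.aleph0_le_mk Θ)]
  have hen : ∀ i, ∃ en : Θ → ℕ, Set.InjOn en (cf i) := fun i => Set.countable_iff_exists_injOn.1 (hcfc i)
  choose en hen using hen
  have hk : ∀ β, ∃ k : ℕ, ∃ h : Θ → ℕ, ∀ m α n, R β m α n → k < m → n ≤ h α := by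
    intro β
    obtain ⟨g, f, h⟩ := hd {β} (by
      rw [Cardinal.mk_singleton]
      exact lt_of_lt_of_le Cardinal.one_lt_aleph0 (Cardinal.aleph0_le_mk Θ))
    exact ⟨g β, f, fun m α n hR hm => h β m α n hR rfl hm⟩
  choose kk hh hkh using hk
  let xt : Θ → ℕ → ℕ := fun j m => (Finset.range (m+1)).sup (xf j)
  let P : Θ → ℕ → Θ → ℕ → Prop := fun i m α n =>
    R (e i).1 m α n ∧ kk (e i).1 < m ∧ α ∈ cf (e i).2.1 ∧ en (e i).2.1 α ≤ xt (e i).2.2 m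
  let N : Θ → Θ → ℕ := fun i α => sSup {n | ∃ m, P i m α n}
  have hbdd : ∀ i α, BddAbove {n | ∃ m, P i m α n} := by
    rintro i α
    refine ⟨hh (e i).1 α, ?_⟩
    rintro n ⟨m, hP⟩
    exact hkh _ _ _ _ hP.1 hP.2.1
  have hle : ∀ i m α n, P i m α n → n ≤ N i α := fun i m α n h => le_csSup (hbdd i α) ⟨m, h⟩
  have hmem : ∀ i α, N i α = 0 ∨ ∃ m, P i m α (N i α) := by
    intro i α
    by_cases hne : {n | ∃ m, P i m α n}.Nonempty
    · exact Or.inr (Nat.sSup_mem hne (hbdd i α))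
    · left
      rw [Set.not_nonempty_iff_eq_empty] at hne
      change sSup _ = 0
      rw [hne]; simp
  have hfin : ∀ i M, ∃ k, ∀ m α n, P i m α n → m ≤ M → n ≤ k := by
    intro i M
    have h1 : {α | α ∈ cf (e i).2.1 ∧ en (e i).2.1 α ≤ xt (e i).2.2 M}.Finite := by
      refine Set.Finite.of_finite_image (f := en (e i).2.1) ?_ ((hen _).mono fun a h => h.1)
      refine (Set.finite_Iic (xt (e i).2.2 M)).subset ?_
      rintro _ ⟨a, h, rfl⟩
      exact h.2
    refine ⟨h1.toFinset.sup (hh (e i).1), fun m α n hP hm => ?_⟩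
    refine (hkh _ _ _ _ hP.1 hP.2.1).trans (Finset.le_sup (f := hh (e i).1) ?_)
    rw [Set.Finite.mem_toFinset]
    refine ⟨hP.2.2.1, hP.2.2.2.trans (Finset.sup_mono ?_)⟩
    intro j
    simp only [Finset.mem_range]
    omega
  refine ⟨N, ?_, ?_, ?_⟩
  · rintro ⟨g, hg⟩
    -- some `β` is not bounded by `g`
    obtain ⟨β, hβ⟩ : ∃ β, ∀ k, ∃ m α n, R β m α n ∧ k < m ∧ g α < n := by
      by_contra hcon
      push Not at hcon
      choose k hk using hcon
      obtain ⟨β, m, α, n, hR, h1, h2⟩ := ha k g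
      exact absurd h2 (not_lt.2 (hk β m α n hR h1))
    have hβ' := fun k => hβ (max k (kk β))
    choose m a n hR hm hn using hβ'
    obtain ⟨c, hc⟩ := hcf (Set.range a) (Set.countable_range a)
    obtain ⟨j, hj⟩ := hxf (fun l => en c (a l))
    obtain ⟨k, hk⟩ := hg (e.symm (β, c, j))
    have hinf : {l | ¬ xf j l ≤ en c (a l)}.Infinite := hj
    obtain ⟨l, hl, hkl⟩ := hinf.exists_gt k
    have hml := hm l
    have hlm : l < m l := lt_of_le_of_lt (le_max_left _ _) hml
    have hP : P (e.symm (β, c, j)) (m l) (a l) (n l) := by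
      simp only [P, Equiv.apply_symm_apply]
      refine ⟨hR l, lt_of_le_of_lt (le_max_right _ _) hml, hc ⟨l, rfl⟩, ?_⟩
      have : xf j l ≤ xt j (m l) := Finset.le_sup (f := xf j) (by simp; omega)
      have hl' : ¬ xf j l ≤ en c (a l) := hl
      omega
    have h1 := hle _ _ _ _ hP
    have h2 := hmn _ _ _ _ (hR l)
    have h3 := hn l
    rcases hk (a l) with h | h <;> omega
  · intro G hG
    obtain ⟨g, f, h⟩ := hd ((fun i => (e i).1) '' G) (lt_of_le_of_lt Cardinal.mk_image_le hG)
    refine ⟨f, fun i hi => ?_⟩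
    obtain ⟨k, hk⟩ := hfin i (g (e i).1)
    refine ⟨k, fun α => ?_⟩
    rcases hmem i α with h0 | ⟨m, hP⟩
    · left; omega
    · by_cases hm : m ≤ g (e i).1
      · exact Or.inr (hk _ _ _ hP hm)
      · exact Or.inl (h _ _ _ _ hP.1 ⟨i, hi, rfl⟩ (not_le.1 hm))
  · intro B hB
    obtain ⟨g, f, h⟩ := hc B hB
    refine ⟨fun α => f α, fun i => ?_⟩
    obtain ⟨k, hk⟩ := hfin i (g (e i).1)
    refine ⟨k, fun α => ?_⟩
    rcases hmem i α with h0 | ⟨m, hP⟩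
    · left; dsimp only; omega
    · by_cases hm : m ≤ g (e i).1
      · exact Or.inr (hk _ _ _ hP hm)
      · exact Or.inl (h _ _ _ _ hP.1 α.2 (not_le.1 hm))

/-- Theorem 4.1: assume `𝔟 ≤ θ` and `cov(ω,θ) ≤ θ`.  Then there is a
`(θ,θ)`-good set iff there is a `≤⁺`-unbounded `θ`-indexed family of
functions `θ → ω` such that every subfamily of size `< θ` is `≤⁺`-bounded and
every restriction to a set of size `< θ` is `≤⁺`-bounded.  Here `θ = #Θ`. -/
theorem statement12 {Θ : Type} [Infinite Θ]
    (hbθ : ∃ F : Set (ℕ → ℕ), #F ≤ #Θ ∧ ¬ ∃ g : ℕ → ℕ, ∀ f ∈ F, LeStar f g)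
    (hcov : ∃ C : Set (Set Θ), #C ≤ #Θ ∧ (∀ c ∈ C, c.Countable) ∧
      ∀ B : Set Θ, B.Countable → ∃ c ∈ C, B ⊆ c) :
    (∃ A : Set ((Θ × ℕ) × (Θ × ℕ)), IsGoodSelf A) ↔
    (∃ f : Θ → Θ → ℕ,
      (¬ ∃ g : Θ → ℕ, ∀ β : Θ, LePlus (f β) g) ∧
      (∀ G : Set Θ, #G < #Θ → ∃ g : Θ → ℕ, ∀ β ∈ G, LePlus (f β) g) ∧
      (∀ B : Set Θ, #B < #Θ →
        ∃ g : B → ℕ, ∀ β : Θ, LePlus (fun α : B => f β α) g)) := by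
  constructor
  · rintro ⟨A, ha, -, hc, hd⟩
    have hc' : ∀ E : Set Θ, #E < #Θ → ∃ g f : Θ → ℕ, ∀ β m α n,
        ((β, m), (α, n)) ∈ A → α ∈ E → g β < m → n ≤ f α := by
      intro E hE
      obtain ⟨g, f, h⟩ := hc E hE
      refine ⟨g, f, fun β m α n hA hα hm => ?_⟩
      by_contra hn
      have : ((β, m), (α, n)) ∈ A ∩ {p | p.2.1 ∈ E} ∩ VU g f := ⟨⟨hA, hα⟩, hm, not_le.1 hn⟩
      rw [h] at this
      exact this
    have hd' : ∀ E : Set Θ, #E < #Θ → ∃ g f : Θ → ℕ, ∀ β m α n,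
        ((β, m), (α, n)) ∈ A → β ∈ E → g β < m → n ≤ f α := by
      intro E hE
      obtain ⟨g, f, h⟩ := hd E hE
      refine ⟨g, f, fun β m α n hA hα hm => ?_⟩
      by_contra hn
      have : ((β, m), (α, n)) ∈ A ∩ {p | p.1.1 ∈ E} ∩ VU g f := ⟨⟨hA, hα⟩, hm, not_le.1 hn⟩
      rw [h] at this
      exact this
    by_cases hcase : ∀ g f : Θ → ℕ, ∃ β m α n, (((β, m), (α, n)) ∈ A ∧ m ≤ n) ∧ g β < m ∧ f α < n
    · refine core_dir hbθ hcov (fun β m α n => ((β, m), (α, n)) ∈ A ∧ m ≤ n)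
        (fun β m α n h => h.2) hcase ?_ ?_
      · intro E hE
        obtain ⟨g, f, h⟩ := hc' E hE
        exact ⟨g, f, fun β m α n hR => h β m α n hR.1⟩
      · intro E hE
        obtain ⟨g, f, h⟩ := hd' E hE
        exact ⟨g, f, fun β m α n hR => h β m α n hR.1⟩
    · push Not at hcase
      obtain ⟨g₀, f₀, h₀⟩ := hcase
      refine core_dir hbθ hcov (fun α n β m => ((β, m), (α, n)) ∈ A ∧ n ≤ m)
        (fun β m α n h => h.2) ?_ ?_ ?_
      · intro f g
        obtain ⟨⟨⟨β, m⟩, ⟨α, n⟩⟩, hA, h1, h2⟩ :=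
          ha (fun β => max (g β) (g₀ β)) (fun α => max (f α) (f₀ α))
        simp only [max_lt_iff] at h1 h2
        refine ⟨α, n, β, m, ⟨hA, ?_⟩, h2.1, h1.1⟩
        by_contra hnm
        have := h₀ β m α n ⟨hA, by omega⟩ h1.2
        omega
      · intro E hE
        obtain ⟨g, f, h⟩ := hd' E hE
        refine ⟨f, g, fun α n β m hR hβ hn => ?_⟩
        by_contra hm
        have := h β m α n hR.1 hβ (not_le.1 hm)
        omega
      · intro E hE
        obtain ⟨g, f, h⟩ := hc' E hE
        refine ⟨f, g, fun α n β m hR hβ hn => ?_⟩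
        by_contra hm
        have := h β m α n hR.1 hβ (not_le.1 hm)
        omega
  · rintro ⟨f, hu, hG, hB⟩
    let A : Set ((Θ × ℕ) × (Θ × ℕ)) := {p | p.1.2 = f p.1.1 p.2.1 ∧ p.2.2 = f p.1.1 p.2.1}
    have hc : ∀ E : Set Θ, #E < #Θ → ∃ g h : Θ → ℕ, A ∩ {p | p.2.1 ∈ E} ∩ VU g h = ∅ := by
      classical
      intro E hE
      obtain ⟨h, hh⟩ := hB E hE
      choose k hk using hh
      refine ⟨k, fun α => if hα : α ∈ E then h ⟨α, hα⟩ else 0, ?_⟩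
      rw [Set.eq_empty_iff_forall_notMem]
      rintro ⟨⟨β, m⟩, ⟨α, n⟩⟩ ⟨⟨⟨h1, h2⟩, hα⟩, h3, h4⟩
      have hα' : α ∈ E := hα
      simp only [hα', dif_pos] at h1 h2 h3 h4
      rcases hk β ⟨α, hα'⟩ with h5 | h5 <;> simp only at h5 <;> omega
    refine ⟨A, ?_, ?_, hc, ?_⟩
    · intro g h
      by_contra hne
      apply hu
      refine ⟨h, fun β => ⟨g β, fun α => ?_⟩⟩
      by_contra hcon
      push Not at hcon
      exact hne ⟨((β, f β α), (α, f β α)), ⟨rfl, rfl⟩, hcon.2, hcon.1⟩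
    · intro B hBA hBc
      obtain ⟨g, h, hgh⟩ := hc ((fun p => p.2.1) '' B) (lt_of_le_of_lt Cardinal.mk_image_le hBc)
      refine ⟨g, h, ?_⟩
      rw [Set.eq_empty_iff_forall_notMem] at hgh ⊢
      rintro p ⟨hp, hp'⟩
      exact hgh p ⟨⟨hBA hp, ⟨p, hp, rfl⟩⟩, hp'⟩
    · classical
      intro G hGc
      obtain ⟨h, hh⟩ := hG G hGc
      have hh' : ∀ β, ∃ k, β ∈ G → ∀ α, f β α ≤ h α ∨ f β α ≤ k := by
        intro β
        by_cases hβ : β ∈ G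
        · obtain ⟨k, hk⟩ := hh β hβ
          exact ⟨k, fun _ => hk⟩
        · exact ⟨0, fun h => absurd h hβ⟩
      choose k hk using hh'
      refine ⟨k, h, ?_⟩
      rw [Set.eq_empty_iff_forall_notMem]
      rintro ⟨⟨β, m⟩, ⟨α, n⟩⟩ ⟨⟨⟨h1, h2⟩, hβ⟩, h3, h4⟩
      simp only at h1 h2 h3 h4
      rcases hk β hβ α with h5 | h5 <;> omega
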